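/- Let T = (V, p) be a directed forest. Then the following conditions are equivalent: (a) every bounded hyponormal weighted shift on T is power hyponormal; (b) the square of every bounded hyponormal weighted shift on T is hyponormal; (c) every leafless directed forest thinner than T is forkless, i.e. for every q : V → V such that (V, q) is a leafless directed forest with q ≼ p, the forest (V, q) is forkless. -/

import Mathlib

noncomputable section

/-- A directed forest structure on `V`: `p` is the parent function, and any
periodic point of `p` is a fixed point. -/
def IsDirectedForest {V : Type*} (p : V → V) : Prop :=
  ∀ n : ℕ, 1 ≤ n → ∀ v : V, p^[n] v = v → p v = v

/-- `p1` is thinner than `p2` if for every vertex `v`, `p1 v ∈ {v, p2 v}`. -/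
def Thinner {V : Type*} (p1 p2 : V → V) : Prop :=
  ∀ v : V, p1 v = v ∨ p1 v = p2 v

/-- A directed forest `(V, p)` is forkless if every non-root vertex has
exactly one child. -/
def Forkless {V : Type*} (p : V → V) : Prop :=
  ∀ v : V, p v ≠ v → ∃! u : V, p u = v ∧ u ≠ v

/-- The Hilbert space ℓ²(V) of square-summable complex functions on `V`. -/
abbrev L2 (V : Type*) := lp (fun _ : V => ℂ) 2

/-- `S` is a (bounded) weighted shift on the directed forest `(V, p)`:
there is a system of weights `lam` (vanishing at roots) such that
`(S f)(v) = lam v * f (p v)` for all `f ∈ ℓ²(V)`. -/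
def IsWeightedShift {V : Type*} (p : V → V) (S : L2 V →L[ℂ] L2 V) : Prop :=
  ∃ lam : V → ℂ, (∀ ω : V, p ω = ω → lam ω = 0) ∧
    ∀ f : L2 V, ∀ v : V, (S f : V → ℂ) v = lam v * (f : V → ℂ) (p v)

/-- A bounded operator on ℓ²(V) is hyponormal if `‖S* f‖ ≤ ‖S f‖` for all `f`. -/
def Hyponormal {V : Type*} (S : L2 V →L[ℂ] L2 V) : Prop :=
  ∀ f : L2 V, ‖(ContinuousLinearMap.adjoint S) f‖ ≤ ‖S f‖

section helpers

open Function

open scoped ComplexConjugate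

open scoped Classical in
/-- Basis vectors of `L2 V`. -/
def bvec {V : Type*} (v : V) : L2 V := lp.single 2 v (1 : ℂ)

theorem bvec_apply_self {V : Type*} (v : V) : (bvec v : V → ℂ) v = 1 := by
  simp [bvec]

theorem bvec_apply_ne {V : Type*} {v x : V} (h : x ≠ v) : (bvec v : V → ℂ) x = 0 := by
  simp [bvec, h]

theorem norm_bvec {V : Type*} (v : V) : ‖bvec v‖ = 1 := by
  simp [bvec]

theorem inner_bvec {V : Type*} (v : V) (f : L2 V) : inner ℂ (bvec v) f = (f : V → ℂ) v := by
  classical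
  unfold bvec
  rw [lp.inner_single_left]
  simp

theorem adjoint_apply_eq {V : Type*} (S : L2 V →L[ℂ] L2 V) (f : L2 V) (x : V) :
    ((ContinuousLinearMap.adjoint S) f : V → ℂ) x = inner ℂ (S (bvec x)) f := by
  rw [← inner_bvec, ContinuousLinearMap.adjoint_inner_right]

/-- pointwise formula for the adjoint at a vertex with finitely many weighted children -/
theorem adjoint_apply_sum {V : Type*} (p : V → V) (S : L2 V →L[ℂ] L2 V) (lam : V → ℂ)
    (hS : ∀ f : L2 V, ∀ v : V, (S f : V → ℂ) v = lam v * (f : V → ℂ) (p v))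
    (x : V) (t : Finset V) (ht : ∀ y ∈ t, p y = x)
    (ht' : ∀ y, lam y ≠ 0 → p y = x → y ∈ t) :
    S (bvec x) = ∑ y ∈ t, lam y • bvec y := by
  ext y
  rw [hS, lp.coeFn_sum, Finset.sum_apply]
  by_cases hy : y ∈ t
  · rw [Finset.sum_eq_single y, ht y hy]
    · simp [bvec_apply_self]
    · intro z _ hz
      simp [bvec_apply_ne hz.symm]
    · exact fun h => absurd hy h
  · rw [Finset.sum_eq_zero]
    · by_cases hl : lam y = 0
      · simp [hl]
      · rw [bvec_apply_ne, mul_zero]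
        exact fun h => hy (ht' y hl h)
    · intro z hz
      have : y ≠ z := fun h => hy (h ▸ hz)
      simp [bvec_apply_ne this]

theorem adjoint_apply_sum' {V : Type*} (p : V → V) (S : L2 V →L[ℂ] L2 V) (lam : V → ℂ)
    (hS : ∀ f : L2 V, ∀ v : V, (S f : V → ℂ) v = lam v * (f : V → ℂ) (p v))
    (x : V) (t : Finset V) (ht : ∀ y ∈ t, p y = x)
    (ht' : ∀ y, lam y ≠ 0 → p y = x → y ∈ t) (f : L2 V) :
    ((ContinuousLinearMap.adjoint S) f : V → ℂ) x = ∑ y ∈ t, conj (lam y) * (f : V → ℂ) y := by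
  rw [adjoint_apply_eq, adjoint_apply_sum p S lam hS x t ht ht', sum_inner]
  simp_rw [inner_smul_left, inner_bvec]

theorem norm_sq_ennreal {V : Type*} (f : L2 V) :
    ENNReal.ofReal (‖f‖ ^ 2) = ∑' x, ENNReal.ofReal (‖(f : V → ℂ) x‖ ^ 2) := by
  have h2 : (0 : ℝ) < (2 : ENNReal).toReal := by norm_num
  have h := lp.hasSum_norm h2 f
  have h' : HasSum (fun x => ‖(f : V → ℂ) x‖ ^ 2) (‖f‖ ^ 2) := by
    simpa using h
  rw [← h'.tsum_eq, ENNReal.ofReal_tsum_of_nonneg (fun _ => by positivity) h'.summable]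

theorem norm_le_of_ennreal {V : Type*} (f g : L2 V)
    (h : ∑' x, ENNReal.ofReal (‖(f : V → ℂ) x‖ ^ 2) ≤ ∑' x, ENNReal.ofReal (‖(g : V → ℂ) x‖ ^ 2)) :
    ‖f‖ ≤ ‖g‖ := by
  rw [← norm_sq_ennreal, ← norm_sq_ennreal, ENNReal.ofReal_le_ofReal_iff (by positivity)] at h
  exact le_of_sq_le_sq h (norm_nonneg _)

/-- Finite sum comparison along a partial injection. -/
theorem sum_le_of_inj {V : Type*} (a b : V → ℝ) (i : V → V)
    (hi : Set.InjOn i {x | a x ≠ 0}) (h : ∀ x, a x ≠ 0 → a x ≤ b (i x)) (s : Finset V) :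
    ∃ t : Finset V, ∑ x ∈ s, a x ≤ ∑ x ∈ t, b x := by
  classical
  refine ⟨(s.filter (fun x => a x ≠ 0)).image i, ?_⟩
  rw [Finset.sum_image]
  · rw [← Finset.sum_filter_ne_zero]
    apply Finset.sum_le_sum
    intro x hx
    exact h x (Finset.mem_filter.1 hx).2
  · intro x hx y hy hxy
    refine hi ?_ ?_ hxy
    · simpa using (Finset.mem_filter.1 hx).2
    · simpa using (Finset.mem_filter.1 hy).2

theorem memlp_of_inj {V : Type*} (f : V → ℂ) (g : L2 V) (C : ℝ) (i : V → V)
    (hi : Set.InjOn i {x | f x ≠ 0}) (h : ∀ x, f x ≠ 0 → ‖f x‖ ≤ C * ‖(g : V → ℂ) (i x)‖) :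
    ∃ hf : Memℓp f 2, ‖(⟨f, hf⟩ : L2 V)‖ ≤ |C| * ‖g‖ := by
  have h2 : (0 : ℝ) < (2 : ENNReal).toReal := by norm_num
  have key : ∀ s : Finset V, ∑ x ∈ s, ‖f x‖ ^ (2 : ENNReal).toReal ≤
      (|C| * ‖g‖) ^ (2 : ENNReal).toReal := by
    intro s
    obtain ⟨t, ht⟩ := sum_le_of_inj (fun x => ‖f x‖ ^ 2)
      (fun x => C ^ 2 * ‖(g : V → ℂ) x‖ ^ 2) i
      (by simpa using hi)
      (by
        intro x hx
        have hx' : f x ≠ 0 := by simpa using hx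
        have := h x hx'
        simp only
        rw [← mul_pow]
        gcongr) s
    have h3 := lp.sum_rpow_le_norm_rpow h2 g t
    simp only [ENNReal.toReal_ofNat, Real.rpow_ofNat] at h3 ⊢
    rw [← Finset.mul_sum] at ht
    rw [mul_pow, sq_abs]
    exact ht.trans (by gcongr)
  refine ⟨memℓp_gen' key, ?_⟩
  exact lp.norm_le_of_forall_sum_le h2 (by positivity) key

theorem norm_le_of_inj {V : Type*} (f g : L2 V) (i : V → V)
    (hi : Set.InjOn i {x | (f : V → ℂ) x ≠ 0})
    (h : ∀ x, (f : V → ℂ) x ≠ 0 → ‖(f : V → ℂ) x‖ ≤ ‖(g : V → ℂ) (i x)‖) : ‖f‖ ≤ ‖g‖ := by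
  obtain ⟨hf, hle⟩ := memlp_of_inj (f : V → ℂ) g 1 i hi (by simpa using h)
  simpa using hle

/-- A bounded weighted shift exists when `p` is injective on the support of the weights. -/
theorem exists_shift {V : Type*} (p : V → V) (mu : V → ℂ) (C : ℝ) (hC : ∀ x, ‖mu x‖ ≤ C)
    (hi : Set.InjOn p {x | mu x ≠ 0}) :
    ∃ S : L2 V →L[ℂ] L2 V, ∀ f : L2 V, ∀ v : V, (S f : V → ℂ) v = mu v * (f : V → ℂ) (p v) := by
  have key : ∀ f : L2 V, ∃ hf : Memℓp (fun v => mu v * (f : V → ℂ) (p v)) 2,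
      ‖(⟨_, hf⟩ : L2 V)‖ ≤ |C| * ‖f‖ := by
    intro f
    apply memlp_of_inj _ f C p
    · intro x hx y hy hxy
      exact hi (left_ne_zero_of_mul hx) (left_ne_zero_of_mul hy) hxy
    · intro x _
      rw [norm_mul]
      gcongr
      exact hC x
  choose hm hn using key
  let T : L2 V →ₗ[ℂ] L2 V :=
    { toFun := fun f => ⟨_, hm f⟩
      map_add' := by
        intro f g
        ext v
        exact mul_add _ _ _
      map_smul' := by
        intro c f
        ext v
        simp [mul_left_comm] }
  exact ⟨T.mkContinuous |C| hn, fun f v => rfl⟩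

theorem ennreal_two_chains {V : Type*} (F G : V → ENNReal) (U W : ℕ → V)
    (hU : Injective U) (hW : Injective W) (hUW : ∀ k j, U (k + 2) ≠ W (j + 2))
    (h0 : ∀ x, (∀ k, x ≠ U k) → (∀ k, x ≠ W k) → F x = 0)
    (h1 : F (U 0) ≤ G (U 2) + G (W 2)) (h2 : F (U 1) ≤ G (U 3) + G (W 3))
    (e0 : U 0 = W 0) (e1 : U 1 = W 1)
    (h3 : ∀ k, F (U (k + 2)) ≤ G (U (k + 4))) (h4 : ∀ k, F (W (k + 2)) ≤ G (W (k + 4))) :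
    ∑' x, F x ≤ ∑' x, G x := by
  classical
  have hle : ∀ x, F x ≤ (∑' k, if x = U k then G (U (k + 2)) else 0) +
      (∑' k, if x = W k then G (W (k + 2)) else 0) := by
    intro x
    have hA : ∀ k, G (U (k + 2)) ≤ ∑' j, if U k = U j then G (U (j + 2)) else 0 := by
      intro k
      refine le_trans ?_ (ENNReal.le_tsum k)
      simp
    have hB : ∀ k, G (W (k + 2)) ≤ ∑' j, if W k = W j then G (W (j + 2)) else 0 := by
      intro k
      refine le_trans ?_ (ENNReal.le_tsum k)
      simp
    by_cases hx : ∃ k, x = U k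
    · obtain ⟨k, rfl⟩ := hx
      match k with
      | 0 =>
        refine h1.trans (add_le_add (hA 0) ?_)
        rw [e0]; exact hB 0
      | 1 =>
        refine h2.trans (add_le_add (hA 1) ?_)
        rw [e1]; exact hB 1
      | k + 2 => exact (h3 k).trans ((hA (k + 2)).trans le_self_add)
    · by_cases hx' : ∃ k, x = W k
      · obtain ⟨k, rfl⟩ := hx'
        match k with
        | 0 => exact absurd ⟨0, e0.symm⟩ hx
        | 1 => exact absurd ⟨1, e1.symm⟩ hx
        | k + 2 => exact (h4 k).trans ((hB (k + 2)).trans le_add_self)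
      · push Not at hx hx'
        rw [h0 x hx hx']
        exact zero_le
  have hswap : ∀ (Y : ℕ → V) (a : ℕ → ENNReal),
      ∑' x, (∑' k, if x = Y k then a k else 0) = ∑' k, a k := by
    intro Y a
    rw [ENNReal.tsum_comm]
    refine tsum_congr fun k => ?_
    rw [tsum_eq_single (Y k)]
    · simp
    · intro x hx
      simp [hx]
  have hG : ∀ x, G x = (if ∃ k, x = U (k + 2) then G x else 0) +
      (if ∃ k, x = U (k + 2) then 0 else G x) := by
    intro x
    split_ifs <;> simp
  calc ∑' x, F x ≤ ∑' x, ((∑' k, if x = U k then G (U (k + 2)) else 0) +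
      (∑' k, if x = W k then G (W (k + 2)) else 0)) := ENNReal.tsum_le_tsum hle
    _ = (∑' k, G (U (k + 2))) + ∑' k, G (W (k + 2)) := by
      rw [ENNReal.tsum_add, hswap, hswap]
    _ ≤ (∑' x, if ∃ k, x = U (k + 2) then G x else 0) +
        ∑' x, if ∃ k, x = U (k + 2) then 0 else G x := by
      apply add_le_add
      · refine le_trans (le_of_eq ?_) (ENNReal.tsum_comp_le_tsum_of_injective
          (f := fun k => U (k + 2)) (fun a b h => by simpa using hU h) _)
        refine tsum_congr fun k => ?_
        rw [if_pos ⟨k, rfl⟩]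
      · refine le_trans (le_of_eq ?_) (ENNReal.tsum_comp_le_tsum_of_injective
          (f := fun k => W (k + 2)) (fun a b h => by simpa using hW h) _)
        refine tsum_congr fun k => ?_
        rw [if_neg]
        rintro ⟨j, hj⟩
        exact hUW j k hj.symm
    _ = ∑' x, G x := by
      rw [← ENNReal.tsum_add]
      exact tsum_congr fun x => (hG x).symm

theorem forest_of_thinner {V : Type*} (p q : V → V) (hp : IsDirectedForest p)
    (hq : Thinner q p) : IsDirectedForest q := by
  have key : ∀ n v, q (q^[n] v) = q^[n] v ∨ q^[n] v = p^[n] v := by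
    intro n v
    induction n with
    | zero => right; rfl
    | succ n ih =>
      rw [iterate_succ_apply', iterate_succ_apply']
      rcases ih with h | h
      · left; rw [h, h]
      · rcases hq (q^[n] v) with h' | h'
        · left; rw [h', h']
        · right; rw [h', h]
  intro n hn v hv
  rcases key n v with h | h
  · rwa [hv] at h
  · have := hp n hn v (h ▸ hv)
    rcases hq v with h' | h'
    · exact h'
    · rw [h', this]

theorem exists_restrict {V : Type*} (g : L2 V) (P : V → Prop) :
    ∃ g' : L2 V, (∀ v, P v → (g' : V → ℂ) v = (g : V → ℂ) v) ∧
      ∀ v, ¬ P v → (g' : V → ℂ) v = 0 := by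
  classical
  obtain ⟨hm, -⟩ := memlp_of_inj (fun v => if P v then (g : V → ℂ) v else 0) g 1 id
    (injective_id.injOn) (by
      intro x hx
      split_ifs <;> simp)
  refine ⟨⟨_, hm⟩, fun v hv => ?_, fun v hv => ?_⟩
  · change (if P v then (g : V → ℂ) v else 0) = _
    rw [if_pos hv]
  · change (if P v then (g : V → ℂ) v else 0) = _
    rw [if_neg hv]

theorem power_hyponormal_of_forkless {V : Type*} (p : V → V) (hp : IsDirectedForest p)
    (hc : ∀ q : V → V, IsDirectedForest q → Function.Surjective q → Thinner q p → Forkless q) :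
    ∀ S : L2 V →L[ℂ] L2 V, IsWeightedShift p S → Hyponormal S →
        ∀ n : ℕ, 1 ≤ n → Hyponormal (S ^ n) := by
  classical
  rintro S ⟨lam, hroot, hS⟩ hyp n hn
  -- norm of the weight is dominated
  have hlamle : ∀ v, ‖lam v‖ ≤ ‖S (bvec v)‖ := by
    intro v
    refine le_trans ?_ (hyp (bvec v))
    refine le_trans (le_of_eq ?_) (lp.norm_apply_le_norm (by norm_num) _ (p v))
    rw [adjoint_apply_eq, ← inner_conj_symm, inner_bvec, hS, bvec_apply_self]
    simp
  have hchild : ∀ v, lam v ≠ 0 → ∃ u, p u = v ∧ lam u ≠ 0 := by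
    intro v hv
    by_contra hcon
    push Not at hcon
    have h0 := adjoint_apply_sum p S lam hS v ∅ (by simp)
      (fun y hy hy' => absurd (hcon y hy') hy)
    have := hlamle v
    rw [h0] at this
    simp at this
    exact hv this
  let q : V → V := fun v => if lam v = 0 then v else p v
  have hqthin : Thinner q p := by
    intro v
    by_cases h : lam v = 0 <;> simp [q, h]
  have hqsurj : Surjective q := by
    intro v
    by_cases h : lam v = 0
    · exact ⟨v, by simp [q, h]⟩
    · obtain ⟨u, hu, hu'⟩ := hchild v h
      exact ⟨u, by simp [q, hu, hu']⟩
  have hfork := hc q (forest_of_thinner p q hp hqthin) hqsurj hqthin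
  have hpne : ∀ v, lam v ≠ 0 → p v ≠ v := fun v hv h => hv (hroot v h)
  have huniq : ∀ v, lam v ≠ 0 → ∀ u1 u2, p u1 = v → lam u1 ≠ 0 → p u2 = v → lam u2 ≠ 0 →
      u1 = u2 := by
    intro v hv u1 u2 h1 h1' h2 h2'
    have hqv : q v ≠ v := by simpa [q, hv] using hpne v hv
    apply (hfork v hqv).unique
    · refine ⟨by simp [q, h1, h1'], ?_⟩
      rintro rfl
      exact hpne _ hv h1
    · refine ⟨by simp [q, h2, h2'], ?_⟩
      rintro rfl
      exact hpne _ hv h2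
  choose! c hcp hcl using hchild
  have hcl' : ∀ v, lam v ≠ 0 → ∀ k, lam (c^[k] v) ≠ 0 := by
    intro v hv k
    induction k with
    | zero => exact hv
    | succ k ih => rw [iterate_succ_apply']; exact hcl _ ih
  have hcp' : ∀ v, lam v ≠ 0 → ∀ k, p^[k] (c^[k] v) = v := by
    intro v hv k
    induction k with
    | zero => rfl
    | succ k ih => rw [iterate_succ_apply' c k v, iterate_succ_apply, hcp _ (hcl' v hv k), ih]
  have hSb : ∀ v, lam v ≠ 0 → S (bvec v) = lam (c v) • bvec (c v) := by
    intro v hv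
    have := adjoint_apply_sum p S lam hS v {c v} (by simp [hcp v hv])
      (fun y hy hy' => by
        rw [Finset.mem_singleton]
        exact huniq v hv _ _ hy' hy (hcp v hv) (hcl v hv))
    simpa using this
  have hmono1 : ∀ v, lam v ≠ 0 → ‖lam v‖ ≤ ‖lam (c v)‖ := by
    intro v hv
    have := hlamle v
    rwa [hSb v hv, norm_smul, norm_bvec, mul_one] at this
  have hmono : ∀ v, lam v ≠ 0 → Monotone (fun k => ‖lam (c^[k] v)‖) := by
    intro v hv
    refine monotone_nat_of_le_succ fun k => ?_
    rw [iterate_succ_apply']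
    exact hmono1 _ (hcl' v hv k)
  have hadj : ∀ f : L2 V, ∀ v, lam v ≠ 0 →
      ((ContinuousLinearMap.adjoint S) f : V → ℂ) v = conj (lam (c v)) * (f : V → ℂ) (c v) := by
    intro f v hv
    rw [adjoint_apply_eq, hSb v hv, inner_smul_left, inner_bvec]
  have hadjk : ∀ k, ∀ f : L2 V, ∀ v, lam v ≠ 0 →
      ‖(((ContinuousLinearMap.adjoint S) ^ k) f : V → ℂ) v‖ =
        (∏ i ∈ Finset.range k, ‖lam (c^[i + 1] v)‖) * ‖(f : V → ℂ) (c^[k] v)‖ := by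
    intro k
    induction k with
    | zero => intro f v _; simp
    | succ k ih =>
      intro f v hv
      rw [pow_succ, mul_apply_eq_comp, ih _ v hv, hadj _ _ (hcl' v hv k),
        Finset.prod_range_succ, norm_mul, RCLike.norm_conj, iterate_succ_apply' c k v, mul_assoc]
  have hSk : ∀ k, ∀ f : L2 V, ∀ v, lam v ≠ 0 →
      ‖((S ^ k) f : V → ℂ) (c^[k] v)‖ =
        (∏ i ∈ Finset.range k, ‖lam (c^[i + 1] v)‖) * ‖(f : V → ℂ) v‖ := by
    intro k f v hv
    induction k with
    | zero => simp
    | succ k ih =>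
      rw [pow_succ', mul_apply_eq_comp, hS, norm_mul, Finset.prod_range_succ,
        iterate_succ_apply' c k v, hcp _ (hcl' v hv k), ih]
      ring
  obtain ⟨k, rfl⟩ : ∃ k, n = k + 1 := ⟨n - 1, by omega⟩
  intro f
  have hadjpow : ContinuousLinearMap.adjoint (S ^ (k + 1)) =
      (ContinuousLinearMap.adjoint S) ^ (k + 1) := by
    rw [← ContinuousLinearMap.star_eq_adjoint, ← ContinuousLinearMap.star_eq_adjoint, star_pow]
  rw [hadjpow, pow_succ', mul_apply_eq_comp]
  set g := ((ContinuousLinearMap.adjoint S) ^ k) f with hg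
  obtain ⟨g', hg1, hg0⟩ := exists_restrict g (fun v => lam v ≠ 0)
  have hgg : (ContinuousLinearMap.adjoint S) g = (ContinuousLinearMap.adjoint S) g' := by
    ext x
    rw [adjoint_apply_eq, adjoint_apply_eq, lp.inner_eq_tsum, lp.inner_eq_tsum]
    refine tsum_congr fun y => ?_
    by_cases hy : lam y = 0
    · rw [hS, hy]; simp
    · rw [hg1 y hy]
  rw [hgg]
  refine (hyp g').trans ?_
  have hsupp : ∀ x, (S g' : V → ℂ) x ≠ 0 → lam x ≠ 0 ∧ lam (p x) ≠ 0 := by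
    intro x hx
    rw [hS] at hx
    refine ⟨left_ne_zero_of_mul hx, fun h => right_ne_zero_of_mul hx (hg0 _ (by simpa using h))⟩
  have hxc : ∀ x, lam x ≠ 0 → lam (p x) ≠ 0 → x = c (p x) := fun x h1 h2 =>
    huniq (p x) h2 _ _ rfl h1 (hcp _ h2) (hcl _ h2)
  refine norm_le_of_inj (S g') _ (fun x => c^[(k + 1) + k] (p x)) ?_ ?_
  · intro x hx y hy hxy
    obtain ⟨h1, h2⟩ := hsupp x hx
    obtain ⟨h3, h4⟩ := hsupp y hy
    have := congrArg p^[(k + 1) + k] hxy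
    simp only [hcp' _ h2, hcp' _ h4] at this
    rw [hxc x h1 h2, hxc y h3 h4, this]
  · intro x hx
    obtain ⟨h1, h2⟩ := hsupp x hx
    obtain ⟨v, hv⟩ : ∃ v, v = p x := ⟨_, rfl⟩
    have hx' := hxc x h1 h2
    rw [hS, ← hv]
    rw [← hv] at h2 hx'
    rw [hg1 v h2, norm_mul, hg, hadjk k f v h2, iterate_add_apply, hSk _ f _ (hcl' v h2 k), hx',
      ← mul_assoc]
    refine mul_le_mul_of_nonneg_right ?_ (norm_nonneg _)
    rw [Finset.prod_range_succ, mul_comm]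
    refine mul_le_mul ?_ ?_ (norm_nonneg _) (by positivity)
    · refine Finset.prod_le_prod (fun _ _ => norm_nonneg _) fun i _ => ?_
      rw [← iterate_add_apply]
      exact hmono v h2 (by omega)
    · rw [← iterate_add_apply]
      exact hmono v h2 (show 1 ≤ k + 1 + k by omega)

theorem counterexample {V : Type*} (p : V → V) (U W : ℕ → V)
    (hU : Injective U) (hW : Injective W) (hUW' : ∀ k j, U (k + 2) ≠ W (j + 2))
    (e0 : U 0 = W 0) (e1 : U 1 = W 1)
    (pU : ∀ k, p (U (k + 1)) = U k) (pW : ∀ k, p (W (k + 1)) = W k) :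
    ∃ S : L2 V →L[ℂ] L2 V, IsWeightedShift p S ∧ Hyponormal S ∧ ¬ Hyponormal (S ^ 2) := by
  classical
  have hUW : ∀ k j, U (k + 2) ≠ W j := by
    intro k j
    match j with
    | 0 => rw [← e0]; exact fun h => by simpa using hU h
    | 1 => rw [← e1]; exact fun h => by simpa using hU h
    | j + 2 => exact hUW' k j
  have hWU : ∀ k j, W (k + 2) ≠ U j := by
    intro k j
    match j with
    | 0 => rw [e0]; exact fun h => by simpa using hW h
    | 1 => rw [e1]; exact fun h => by simpa using hW h
    | j + 2 => exact (hUW' j k).symm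
  let a : ℕ → ℂ := fun k => if k = 0 then 12 else if k = 1 then 3 else 5
  let b : ℕ → ℂ := fun k => if k = 0 then 12 else 15
  have hU1 : Injective (fun k => U (k + 1)) := fun i j h => by simpa using hU h
  have hW2 : Injective (fun k => W (k + 2)) := fun i j h => by simpa using hW h
  obtain ⟨m1, hm1⟩ : ∃ m1 : V → ℂ, m1 = extend (fun k => U (k + 1)) a 0 := ⟨_, rfl⟩
  obtain ⟨m2, hm2⟩ : ∃ m2 : V → ℂ, m2 = extend (fun k => W (k + 2)) b 0 := ⟨_, rfl⟩
  have m1U : ∀ k, m1 (U (k + 1)) = a k := fun k => by rw [hm1]; exact hU1.extend_apply a 0 k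
  have m2W : ∀ k, m2 (W (k + 2)) = b k := fun k => by rw [hm2]; exact hW2.extend_apply b 0 k
  have m1z : ∀ y, (∀ k, y ≠ U (k + 1)) → m1 y = 0 := by
    intro y hy
    rw [hm1, extend_apply']
    · rfl
    · rintro ⟨k, hk⟩; exact hy k hk.symm
  have m2z : ∀ y, (∀ k, y ≠ W (k + 2)) → m2 y = 0 := by
    intro y hy
    rw [hm2, extend_apply']
    · rfl
    · rintro ⟨k, hk⟩; exact hy k hk.symm
  have m1n : ∀ y, m1 y ≠ 0 → ∃ k, y = U (k + 1) := by
    intro y hy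
    by_contra h
    push Not at h
    exact hy (m1z y h)
  have m2n : ∀ y, m2 y ≠ 0 → ∃ k, y = W (k + 2) := by
    intro y hy
    by_contra h
    push Not at h
    exact hy (m2z y h)
  obtain ⟨S1, hS1⟩ := exists_shift p m1 15 (by
    intro x
    by_cases h : m1 x = 0
    · simp [h]
    · obtain ⟨k, rfl⟩ := m1n x h
      rw [m1U]
      simp only [a]
      split_ifs <;> norm_num) (by
    intro x hx y hy hxy
    obtain ⟨k, rfl⟩ := m1n x hx
    obtain ⟨j, rfl⟩ := m1n y hy
    rw [pU, pU] at hxy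
    rw [hU hxy])
  obtain ⟨S2, hS2⟩ := exists_shift p m2 15 (by
    intro x
    by_cases h : m2 x = 0
    · simp [h]
    · obtain ⟨k, rfl⟩ := m2n x h
      rw [m2W]
      simp only [b]
      split_ifs <;> norm_num) (by
    intro x hx y hy hxy
    obtain ⟨k, rfl⟩ := m2n x hx
    obtain ⟨j, rfl⟩ := m2n y hy
    rw [pW, pW] at hxy
    have := hW hxy
    rw [show k = j by omega])
  obtain ⟨lam, hlam⟩ : ∃ lam : V → ℂ, ∀ x, lam x = m1 x + m2 x := ⟨_, fun _ => rfl⟩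
  obtain ⟨S, hSdef⟩ : ∃ S : L2 V →L[ℂ] L2 V, S = S1 + S2 := ⟨_, rfl⟩
  have hS : ∀ f : L2 V, ∀ v : V, (S f : V → ℂ) v = lam v * (f : V → ℂ) (p v) := by
    intro f v
    rw [hSdef, hlam, add_mul, ← hS1, ← hS2]
    rfl
  have lU : ∀ k, lam (U (k + 1)) = a k := by
    intro k
    rw [hlam, m1U, m2z, add_zero]
    exact fun j => (hWU j _).symm
  have lW : ∀ k, lam (W (k + 2)) = b k := by
    intro k
    rw [hlam, m2W, m1z, zero_add]
    exact fun j => hWU _ _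
  have lU1 : lam (U 1) = 12 := lU 0
  have lU2 : lam (U 2) = 3 := lU 1
  have lU3 : ∀ k, lam (U (k + 3)) = 5 := fun k => by rw [lU (k + 2)]; simp [a]
  have lW2 : lam (W 2) = 12 := lW 0
  have lW3 : ∀ k, lam (W (k + 3)) = 15 := fun k => by rw [lW (k + 1)]; simp [b]
  have ln : ∀ y, lam y ≠ 0 → (∃ k, y = U (k + 1)) ∨ ∃ k, y = W (k + 2) := by
    intro y hy
    by_contra h
    push Not at h
    apply hy
    rw [hlam, m1z y h.1, m2z y h.2, add_zero]
  have hroot : ∀ ω : V, p ω = ω → lam ω = 0 := by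
    intro ω hω
    by_contra h
    rcases ln ω h with ⟨k, rfl⟩ | ⟨k, rfl⟩
    · rw [pU] at hω
      have := hU hω
      omega
    · rw [pW] at hω
      have := hW hω
      omega
  have c12 : conj (12 : ℂ) = 12 := map_ofNat _ 12
  have c3 : conj (3 : ℂ) = 3 := map_ofNat _ 3
  have A0 : ∀ f : L2 V, ((ContinuousLinearMap.adjoint S) f : V → ℂ) (U 0) =
      12 * (f : V → ℂ) (U 1) := by
    intro f
    rw [adjoint_apply_sum' p S lam hS (U 0) {U 1} (by simp [pU]) ?_ f]
    · simp [lU1, c12]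
    · intro y hy hpy
      rcases ln y hy with ⟨k, rfl⟩ | ⟨k, rfl⟩
      · rw [pU] at hpy
        simp [hU hpy]
      · rw [pW, e0] at hpy
        have := hW hpy
        omega
  have A1 : ∀ f : L2 V, ((ContinuousLinearMap.adjoint S) f : V → ℂ) (U 1) =
      3 * (f : V → ℂ) (U 2) + 12 * (f : V → ℂ) (W 2) := by
    intro f
    rw [adjoint_apply_sum' p S lam hS (U 1) {U 2, W 2} (by simp [pU, pW, e1]) ?_ f]
    · rw [Finset.sum_pair (hUW 0 2)]
      simp [lU2, lW2, c12, c3]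
    · intro y hy hpy
      rcases ln y hy with ⟨k, rfl⟩ | ⟨k, rfl⟩
      · rw [pU] at hpy
        simp [hU hpy]
      · rw [pW, e1] at hpy
        have := hW hpy
        obtain rfl : k = 0 := by omega
        simp
  have SU : ∀ k, S (bvec (U (k + 2))) = (5 : ℂ) • bvec (U (k + 3)) := by
    intro k
    rw [adjoint_apply_sum p S lam hS (U (k + 2)) {U (k + 3)} (by simp [pU])]
    · simp [lU3]
    · intro y hy hpy
      rcases ln y hy with ⟨j, rfl⟩ | ⟨j, rfl⟩
      · rw [pU] at hpy
        simp [hU hpy]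
      · rw [pW] at hpy
        exact absurd hpy.symm (hUW _ _)
  have SW : ∀ k, S (bvec (W (k + 2))) = (15 : ℂ) • bvec (W (k + 3)) := by
    intro k
    rw [adjoint_apply_sum p S lam hS (W (k + 2)) {W (k + 3)} (by simp [pW])]
    · simp [lW3]
    · intro y hy hpy
      rcases ln y hy with ⟨j, rfl⟩ | ⟨j, rfl⟩
      · rw [pU] at hpy
        exact absurd hpy.symm (hWU _ _)
      · rw [pW] at hpy
        have := hW hpy
        obtain rfl : j = k + 1 := by omega
        simp
  refine ⟨S, ⟨lam, hroot, hS⟩, ?_, ?_⟩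
  · intro f
    apply norm_le_of_ennreal
    refine ennreal_two_chains _ _ U W hU hW hUW' ?_ ?_ ?_ e0 e1 ?_ ?_
    · intro x hx hx'
      rw [adjoint_apply_sum' p S lam hS x ∅ (by simp) ?_ f]
      · simp
      · intro y hy hpy
        rcases ln y hy with ⟨j, rfl⟩ | ⟨j, rfl⟩
        · rw [pU] at hpy
          exact absurd hpy.symm (hx j)
        · rw [pW] at hpy
          exact absurd hpy.symm (hx' _)
    · rw [← ENNReal.ofReal_add (by positivity) (by positivity), A0, hS, hS, lU2, lW2, pU, pW, ← e1]
      apply ENNReal.ofReal_le_ofReal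
      simp only [norm_mul, Complex.norm_ofNat]
      nlinarith [sq_nonneg ‖(f : V → ℂ) (U 1)‖]
    · rw [← ENNReal.ofReal_add (by positivity) (by positivity), A1, hS, hS, lU3 0, lW3 0, pU, pW]
      apply ENNReal.ofReal_le_ofReal
      have h := norm_add_le (3 * (f : V → ℂ) (U 2)) (12 * (f : V → ℂ) (W 2))
      simp only [norm_mul, Complex.norm_ofNat] at h ⊢
      have h' := pow_le_pow_left₀ (norm_nonneg _) h 2
      nlinarith [sq_nonneg (4 * ‖(f : V → ℂ) (U 2)‖ - 9 * ‖(f : V → ℂ) (W 2)‖)]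
    · intro k
      rw [adjoint_apply_eq, SU, inner_smul_left, inner_bvec, hS, lU3 (k + 1), pU]
      simp
    · intro k
      rw [adjoint_apply_eq, SW, inner_smul_left, inner_bvec, hS, lW3 (k + 1), pW]
      simp
  · intro hcon
    have h := hcon (bvec (U 2))
    have h1 : (((ContinuousLinearMap.adjoint (S ^ 2)) (bvec (U 2)) : L2 V) : V → ℂ) (U 0) = 36 := by
      rw [← ContinuousLinearMap.star_eq_adjoint, star_pow, ContinuousLinearMap.star_eq_adjoint,
        pow_two, mul_apply_eq_comp, A0, A1, bvec_apply_self, bvec_apply_ne (hWU 0 2)]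
      norm_num
    have h2 : (S ^ 2) (bvec (U 2)) = (25 : ℂ) • bvec (U 4) := by
      rw [pow_two, mul_apply_eq_comp, SU 0, map_smul, SU 1, smul_smul]
      norm_num
    have h3 := lp.norm_apply_le_norm (by norm_num)
      ((ContinuousLinearMap.adjoint (S ^ 2)) (bvec (U 2))) (U 0)
    rw [h1] at h3
    rw [h2, norm_smul, norm_bvec] at h
    have := h3.trans h
    norm_num at this

theorem chain_props {V : Type*} (q : V → V) (hq : IsDirectedForest q) (Y : ℕ → V)
    (hY : ∀ k, q (Y (k + 1)) = Y k) (hr : ∀ k, q (Y (k + 1)) ≠ Y (k + 1)) :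
    Injective Y ∧ ∀ k j, q^[k] (Y (j + k)) = Y j := by
  have h : ∀ k j, q^[k] (Y (j + k)) = Y j := by
    intro k
    induction k with
    | zero => intro j; rfl
    | succ k ih =>
      intro j
      rw [iterate_succ_apply, ← add_assoc, hY, ih]
  refine ⟨?_, h⟩
  have key : ∀ i d, Y i ≠ Y (i + (d + 1)) := by
    intro i d he
    have h1 := h (d + 1) i
    rw [he] at h1
    exact hr (i + d) (hq (d + 1) (by omega) _ h1)
  intro i j hij
  rcases lt_trichotomy i j with hlt | heq | hlt
  · obtain ⟨d, rfl⟩ := Nat.exists_eq_add_of_lt hlt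
    exact absurd hij (key i d)
  · exact heq
  · obtain ⟨d, rfl⟩ := Nat.exists_eq_add_of_lt hlt
    exact absurd hij.symm (key j d)

/-- The branch `r, v, u, s u, s (s u), ...`. -/
def branch {V : Type*} (s : V → V) (r v u : V) : ℕ → V
  | 0 => r
  | 1 => v
  | k + 2 => s^[k] u

theorem branch_props {V : Type*} (q s : V → V) (hs : ∀ x, q (s x) = x) (v u : V)
    (hv : q v ≠ v) (hu : q u = v) :
    (∀ k, q (branch s (q v) v u (k + 1)) = branch s (q v) v u k) ∧
    ∀ k, q (branch s (q v) v u (k + 1)) ≠ branch s (q v) v u (k + 1) := by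
  have h1 : ∀ k, q (branch s (q v) v u (k + 1)) = branch s (q v) v u k := by
    intro k
    match k with
    | 0 => rfl
    | 1 => exact hu
    | k + 2 =>
      change q (s^[k + 1] u) = s^[k] u
      rw [iterate_succ_apply', hs]
  refine ⟨h1, fun k => ?_⟩
  induction k with
  | zero => exact hv
  | succ k ih =>
    intro h
    apply ih
    rw [h1 (k + 1)] at h
    rw [h, h1 (k + 1), h]

theorem forkless_of_square_hyponormal {V : Type*} (p : V → V)
    (hb : ∀ S : L2 V →L[ℂ] L2 V, IsWeightedShift p S → Hyponormal S → Hyponormal (S ^ 2)) :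
    ∀ q : V → V, IsDirectedForest q → Function.Surjective q → Thinner q p → Forkless q := by
  intro q hq hsurj hthin v hv
  obtain ⟨u, hu⟩ := hsurj v
  refine ⟨u, ⟨hu, fun h => hv (h ▸ hu)⟩, ?_⟩
  rintro w ⟨hw, -⟩
  by_contra hne
  choose s hs using hsurj
  obtain ⟨hU1, hU2⟩ := branch_props q s hs v u hv hu
  obtain ⟨hW1, hW2⟩ := branch_props q s hs v w hv hw
  obtain ⟨hUi, hUk⟩ := chain_props q hq _ hU1 hU2
  obtain ⟨hWi, hWk⟩ := chain_props q hq _ hW1 hW2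
  have hpq : ∀ x, q x ≠ x → p x = q x := fun x hx => ((hthin x).resolve_left hx).symm
  have key : ∀ u w : V, q u = v → q w = v → u ≠ w → ∀ k d,
      branch s (q v) v u (k + 2) ≠ branch s (q v) v w (k + d + 2) := by
    intro u w hu hw hne k d he
    obtain ⟨hU1, hU2⟩ := branch_props q s hs v u hv hu
    obtain ⟨hW1, hW2⟩ := branch_props q s hs v w hv hw
    obtain ⟨hUi, hUk⟩ := chain_props q hq _ hU1 hU2
    obtain ⟨hWi, hWk⟩ := chain_props q hq _ hW1 hW2
    have h1 := hUk k 2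
    rw [add_comm 2 k, he, show k + d + 2 = (d + 2) + k by omega, hWk k (d + 2)] at h1
    have h2 := congrArg q h1
    rw [hW1 (d + 1), hU1 1] at h2
    have h3 : d + 1 = 1 := hWi h2
    obtain rfl : d = 0 := by omega
    exact hne h1.symm
  obtain ⟨S, hS1, hS2, hS3⟩ := counterexample p (branch s (q v) v u) (branch s (q v) v w) hUi hWi
    (by
      intro k j h
      rcases le_total k j with hkj | hkj
      · obtain ⟨d, rfl⟩ := Nat.exists_eq_add_of_le hkj
        exact key u w hu hw (Ne.symm hne) k d h
      · obtain ⟨d, rfl⟩ := Nat.exists_eq_add_of_le hkj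
        exact key w u hw hu hne j d h.symm)
    rfl rfl (fun k => by rw [hpq _ (hU2 k), hU1]) (fun k => by rw [hpq _ (hW2 k), hW1])
  exact hS3 (hb S hS1 hS2)

end helpers

theorem stmt_19 {V : Type*} [Nonempty V] (p : V → V)
    (hp : IsDirectedForest p) :
    ((∀ S : L2 V →L[ℂ] L2 V, IsWeightedShift p S → Hyponormal S →
        ∀ n : ℕ, 1 ≤ n → Hyponormal (S ^ n)) ↔
      (∀ q : V → V, IsDirectedForest q → Function.Surjective q → Thinner q p →
        Forkless q)) ∧
    ((∀ S : L2 V →L[ℂ] L2 V, IsWeightedShift p S → Hyponormal S →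
        Hyponormal (S ^ 2)) ↔
      (∀ q : V → V, IsDirectedForest q → Function.Surjective q → Thinner q p →
        Forkless q)) := by
  have hac := power_hyponormal_of_forkless p hp
  have hbc := forkless_of_square_hyponormal p
  refine ⟨⟨fun ha => hbc fun S h1 h2 => ha S h1 h2 2 (by norm_num), hac⟩,
    ⟨hbc, fun hc S h1 h2 => hac hc S h1 h2 2 (by norm_num)⟩⟩
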